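/- Let (X, f_{0,∞}) be a non-autonomous dynamical system on a compact metric space. Then (X, f_{0,∞}) has h-shadowing if and only if the induced hyperspace system (K(X), \bar f_{0,∞}) has h-shadowing. -/

import Mathlib

open Filter Topology TopologicalSpace

/-- `comps f n` is `f_0^n = f_{n-1} ∘ ⋯ ∘ f_0`. -/
def comps {X : Type*} (f : ℕ → X → X) : ℕ → X → X
  | 0 => id
  | n + 1 => f n ∘ comps f n

/-- The non-autonomous system `(X, f_{0,∞})` has `h`-shadowing: for every `ε > 0`
there is `δ > 0` such that for every finite `δ`-pseudo orbit `{c 0, …, c m}` there is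
`z` with `dist (f_0^k(z), c k) < ε` for `k < m` and `f_0^m(z) = c m`. -/
def HShadowing {X : Type*} [MetricSpace X] (f : ℕ → X → X) : Prop :=
  ∀ ε > (0 : ℝ), ∃ δ > (0 : ℝ), ∀ (m : ℕ) (c : ℕ → X),
    (∀ i < m, dist (f i (c i)) (c (i + 1)) < δ) →
    ∃ z : X, (∀ k < m, dist (comps f k z) (c k) < ε) ∧ comps f m z = c m

theorem comps_coe {X : Type*} [MetricSpace X]
    (f : ℕ → X → X) (F : ℕ → NonemptyCompacts X → NonemptyCompacts X)
    (hF : ∀ n (K : NonemptyCompacts X), (F n K : Set X) = f n '' ↑K)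
    (n : ℕ) (K : NonemptyCompacts X) : ((comps F n K : NonemptyCompacts X) : Set X) = comps f n '' ↑K := by
  induction n with
  | zero => simp [comps]
  | succ n ih => simp only [comps, Function.comp_apply, hF, ih, Set.image_image]

theorem comps_continuous {X : Type*} [MetricSpace X]
    (f : ℕ → X → X) (hf : ∀ n, Continuous (f n)) (n : ℕ) : Continuous (comps f n) := by
  induction n with
  | zero => exact continuous_id
  | succ n ih => exact (hf n).comp ih

theorem chain_exists {X : Type*} (R : ℕ → X → X → Prop) (A : ℕ → Set X) (n : ℕ)
    (fw : ∀ i < n, ∀ x ∈ A i, ∃ y ∈ A (i + 1), R i x y)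
    (bw : ∀ i < n, ∀ y ∈ A (i + 1), ∃ x ∈ A i, R i x y) :
    ∀ j ≤ n, ∀ x ∈ A j, ∃ c : ℕ → X, c j = x ∧ (∀ i ≤ n, c i ∈ A i) ∧
      ∀ i < n, R i (c i) (c (i + 1)) := by
  induction n with
  | zero =>
    intro j hj x hx
    obtain rfl : j = 0 := by omega
    refine ⟨fun _ => x, rfl, fun i hi => ?_, fun i hi => by omega⟩
    obtain rfl : i = 0 := by omega
    exact hx
  | succ n ih =>
    have ih := ih (fun i hi => fw i (by omega)) (fun i hi => bw i (by omega))
    have ext : ∀ (c : ℕ → X) (y : X), y ∈ A (n + 1) → R n (c n) y → (∀ i ≤ n, c i ∈ A i) →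
        (∀ i < n, R i (c i) (c (i + 1))) →
        (∀ i ≤ n + 1, Function.update c (n + 1) y i ∈ A i) ∧
        ∀ i < n + 1, R i (Function.update c (n + 1) y i) (Function.update c (n + 1) y (i + 1)) := by
      intro c y hy hR hA hc
      constructor
      · intro i hi
        rcases eq_or_ne i (n + 1) with rfl | h
        · simpa using hy
        · rw [Function.update_of_ne h]
          exact hA i (by omega)
      · intro i hi
        rw [Function.update_of_ne (show i ≠ n + 1 by omega)]
        rcases eq_or_ne i n with rfl | h
        · simpa using hR
        · rw [Function.update_of_ne (show i + 1 ≠ n + 1 by omega)]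
          exact hc i (by omega)
    intro j hj x hx
    rcases eq_or_ne j (n + 1) with rfl | h
    · obtain ⟨y, hy, hR⟩ := bw n (by omega) x hx
      obtain ⟨c, rfl, hA, hc⟩ := ih n le_rfl y hy
      exact ⟨Function.update c (n + 1) x, by simp, ext c x hx hR hA hc⟩
    · obtain ⟨c, rfl, hA, hc⟩ := ih j (by omega) x hx
      obtain ⟨y, hy, hR⟩ := fw n (by omega) (c n) (hA n le_rfl)
      exact ⟨Function.update c (n + 1) y, Function.update_of_ne h _ _, ext c y hy hR hA hc⟩

theorem fin_edist {X : Type*} [MetricSpace X] (K L : NonemptyCompacts X) :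
    Metric.hausdorffEDist (K : Set X) L ≠ ⊤ :=
  Metric.hausdorffEDist_ne_top_of_nonempty_of_bounded K.nonempty L.nonempty
    K.isCompact.isBounded L.isCompact.isBounded

/-- `(X, f_{0,∞})` has `h`-shadowing iff the induced hyperspace system
`(K(X), \bar f_{0,∞})` has `h`-shadowing, where `K(X)` is the space of nonempty compact
subsets of `X` with the Hausdorff metric and `F n` is the induced map, characterized by
`F n K = f n '' K`. -/
theorem hShadowing_iff_hyperspace {X : Type*} [MetricSpace X] [CompactSpace X]
    (f : ℕ → X → X) (hf : ∀ n, Continuous (f n))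
    (F : ℕ → NonemptyCompacts X → NonemptyCompacts X)
    (hF : ∀ n (K : NonemptyCompacts X), (F n K : Set X) = f n '' ↑K) :
    HShadowing f ↔ HShadowing F := by
  constructor
  · intro H ε hε
    obtain ⟨δ, hδ, H⟩ := H (ε / 2) (by positivity)
    refine ⟨δ, hδ, fun m A hA => ?_⟩
    have key := chain_exists (fun i x y => dist (f i x) y < δ) (fun i => (A i : Set X)) m
      (by
        intro i hi x hx
        have h := hA i hi
        rw [Metric.NonemptyCompacts.dist_eq] at h
        exact Metric.exists_dist_lt_of_hausdorffDist_lt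
          (by rw [hF]; exact Set.mem_image_of_mem _ hx) h (fin_edist _ _))
      (by
        intro i hi y hy
        have h := hA i hi
        rw [Metric.NonemptyCompacts.dist_eq] at h
        obtain ⟨w, hw, hd⟩ := Metric.exists_dist_lt_of_hausdorffDist_lt' hy h (fin_edist _ _)
        rw [hF] at hw
        obtain ⟨x, hx, rfl⟩ := hw
        exact ⟨x, hx, hd⟩)
    let S : Set X := {z | comps f m z ∈ A m ∧
      ∀ k < m, Metric.infDist (comps f k z) (A k : Set X) ≤ ε / 2}
    have hS : ∀ j ≤ m, ∀ x ∈ A j, ∃ z ∈ S, dist (comps f j z) x ≤ ε / 2 ∧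
        (j = m → comps f j z = x) := by
      intro j hj x hx
      obtain ⟨c, rfl, hcA, hc⟩ := key j hj x hx
      obtain ⟨z, hz, hzm⟩ := H m c hc
      refine ⟨z, ⟨?_, fun k hk => ?_⟩, ?_, ?_⟩
      · rw [hzm]; exact hcA m le_rfl
      · exact (Metric.infDist_le_dist_of_mem (hcA k hk.le)).trans (hz k hk).le
      · rcases hj.eq_or_lt with rfl | h
        · rw [hzm, dist_self]; positivity
        · exact (hz j h).le
      · rintro rfl; exact hzm
    have hclosed : IsClosed S := by
      have h1 : IsClosed {z | comps f m z ∈ (A m : Set X)} :=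
        (A m).isCompact.isClosed.preimage (comps_continuous f hf m)
      have h2 : IsClosed {z | ∀ k < m, Metric.infDist (comps f k z) (A k : Set X) ≤ ε / 2} := by
        simp only [Set.ofPred_forall]
        exact isClosed_iInter fun k => isClosed_iInter fun _ => isClosed_le
          ((Metric.continuous_infDist_pt _).comp (comps_continuous f hf k)) continuous_const
      exact h1.inter h2
    have hne : S.Nonempty := by
      obtain ⟨x, hx⟩ := (A m).nonempty
      obtain ⟨z, hz, -⟩ := hS m le_rfl x hx
      exact ⟨z, hz⟩
    refine ⟨⟨⟨S, hclosed.isCompact⟩, hne⟩, fun k hk => ?_, ?_⟩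
    · rw [Metric.NonemptyCompacts.dist_eq, comps_coe f F hF]
      refine lt_of_le_of_lt (Metric.hausdorffDist_le_of_mem_dist (r := ε / 2) (by positivity) ?_ ?_)
        (by linarith)
      · rintro _ ⟨z, hz, rfl⟩
        obtain ⟨a, ha, he⟩ := (A k).isCompact.exists_infDist_eq_dist (A k).nonempty (comps f k z)
        exact ⟨a, ha, he ▸ hz.2 k hk⟩
      · intro x hx
        obtain ⟨z, hz, hd, -⟩ := hS k hk.le x hx
        exact ⟨_, ⟨z, hz, rfl⟩, by rwa [dist_comm]⟩
    · apply SetLike.coe_injective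
      rw [comps_coe f F hF]
      apply Set.Subset.antisymm
      · rintro _ ⟨z, hz, rfl⟩
        exact hz.1
      · intro x hx
        obtain ⟨z, hz, -, he⟩ := hS m le_rfl x hx
        exact ⟨z, hz, he rfl⟩
  · intro H ε hε
    obtain ⟨δ, hδ, H⟩ := H ε hε
    refine ⟨δ, hδ, fun m c hc => ?_⟩
    obtain ⟨K, hK, hKm⟩ := H m (fun i => {c i}) (by
      intro i hi
      have : F i {c i} = {f i (c i)} := by
        apply SetLike.coe_injective
        rw [hF]; simp
      rw [this, NonemptyCompacts.isometry_singleton.dist_eq]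
      exact hc i hi)
    obtain ⟨z, hz⟩ := K.nonempty
    have hmem : ∀ k, comps f k z ∈ ((comps F k K : NonemptyCompacts X) : Set X) := by
      intro k
      rw [comps_coe f F hF]
      exact ⟨z, hz, rfl⟩
    refine ⟨z, fun k hk => ?_, ?_⟩
    · have h := hK k hk
      rw [Metric.NonemptyCompacts.dist_eq] at h
      obtain ⟨y, hy, hd⟩ := Metric.exists_dist_lt_of_hausdorffDist_lt (hmem k) h (fin_edist _ _)
      have : y = c k := by simpa using hy
      rwa [this] at hd
    · have h := hmem m
      rw [hKm] at h
      simpa using h
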